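/- Let F(v¹, v², v³, v⁴) = (1/12)v¹(v²)² + (1/12)(v¹)²v³ + (1/4)v¹(v⁴)² + (1/24)v²v³(v⁴)² − (v²)³v³/216 + (v³)³(v⁴)²/432 + (v²)²(v³)³/1296 + (v³)⁷/1632960, a polynomial over ℂ, and let (η^{αβ}) be the 4×4 symmetric matrix with η^{13} = η^{31} = 6, η^{22} = 6, η^{44} = 2 and all other entries 0. Then: (i) for all α, β ∈ {1,2,3,4}, ∂³F/∂v¹∂v^α∂v^β = η_{αβ}, where (η_{αβ}) is the inverse matrix of (η^{αβ}) (so η_{13} = η_{31} = 1/6, η_{22} = 1/6, η_{44} = 1/2, others 0); (ii) F satisfies the WDVV associativity equations: for all α, β, γ, δ ∈ {1,2,3,4}, ∑_{μ,ν=1}^{4} (∂³F/∂v^α∂v^β∂v^μ) η^{μν} (∂³F/∂v^ν∂v^γ∂v^δ) = ∑_{μ,ν=1}^{4} (∂³F/∂v^δ∂v^β∂v^μ) η^{μν} (∂³F/∂v^ν∂v^γ∂v^α); (iii) with E = v¹∂/∂v¹ + (2/3)v²∂/∂v² + (1/3)v³∂/∂v³ + (2/3)v⁴∂/∂v⁴,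 one has E(F) = (7/3)F. -/

import Mathlib

open MvPolynomial

/-- The potential of the `D₄` Frobenius manifold. -/
noncomputable def D4Potential : MvPolynomial (Fin 4) ℂ :=
  C (1/12 : ℂ) * X 0 * X 1 ^ 2 + C (1/12 : ℂ) * X 0 ^ 2 * X 2
    + C (1/4 : ℂ) * X 0 * X 3 ^ 2 + C (1/24 : ℂ) * X 1 * X 2 * X 3 ^ 2
    - C (1/216 : ℂ) * X 1 ^ 3 * X 2 + C (1/432 : ℂ) * X 2 ^ 3 * X 3 ^ 2
    + C (1/1296 : ℂ) * X 1 ^ 2 * X 2 ^ 3 + C (1/1632960 : ℂ) * X 2 ^ 7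

/-- The flat contravariant metric of the `D₄` Frobenius manifold. -/
def D4Metric : Matrix (Fin 4) (Fin 4) ℂ :=
  !![0, 0, 6, 0; 0, 6, 0, 0; 6, 0, 0, 0; 0, 0, 0, 2]

/-- The inverse flat metric `(η_{αβ})` of the `D₄` Frobenius manifold. -/
noncomputable def D4MetricInv : Matrix (Fin 4) (Fin 4) ℂ :=
  !![0, 0, 1/6, 0; 0, 1/6, 0, 0; 1/6, 0, 0, 0; 0, 0, 0, 1/2]

/-- The third partial derivatives of the `D₄` potential, as one symmetric matrix for each
first index. -/
noncomputable def D4ThirdDeriv : Fin 4 → Matrix (Fin 4) (Fin 4) (MvPolynomial (Fin 4) ℂ) :=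
  ![!![0, 0, C (1/6), 0;
      0, C (1/6), 0, 0;
      C (1/6), 0, 0, 0;
      0, 0, 0, C (1/2)],
    !![0, C (1/6), 0, 0;
      C (1/6), -C (1/36) * X 2, -C (1/36) * X 1 + C (1/216) * X 2 ^ 2, 0;
      0, -C (1/36) * X 1 + C (1/216) * X 2 ^ 2, C (1/108) * X 1 * X 2, C (1/12) * X 3;
      0, 0, C (1/12) * X 3, C (1/12) * X 2],
    !![C (1/6), 0, 0, 0;
      0, -C (1/36) * X 1 + C (1/216) * X 2 ^ 2, C (1/108) * X 1 * X 2, C (1/12) * X 3;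
      0, C (1/108) * X 1 * X 2,
        C (1/216) * X 1 ^ 2 + C (1/72) * X 3 ^ 2 + C (1/7776) * X 2 ^ 4, C (1/36) * X 2 * X 3;
      0, C (1/12) * X 3, C (1/36) * X 2 * X 3, C (1/12) * X 1 + C (1/72) * X 2 ^ 2],
    !![0, 0, 0, C (1/2);
      0, 0, C (1/12) * X 3, C (1/12) * X 2;
      0, C (1/12) * X 3, C (1/36) * X 2 * X 3, C (1/12) * X 1 + C (1/72) * X 2 ^ 2;
      C (1/2), C (1/12) * X 2, C (1/12) * X 1 + C (1/72) * X 2 ^ 2, 0]]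

lemma pderiv_ofNat {R σ : Type*} [CommSemiring R] (i : σ) (n : ℕ) [n.AtLeastTwo] :
    pderiv i (ofNat(n) : MvPolynomial σ R) = 0 :=
  (pderiv i).map_natCast n

/-- The first partial derivatives of the `D₄` potential. -/
noncomputable def D4Gradient : Fin 4 → MvPolynomial (Fin 4) ℂ :=
  ![C (1/12) * X 1 ^ 2 + C (1/6) * X 0 * X 2 + C (1/4) * X 3 ^ 2,
    C (1/6) * X 0 * X 1 + C (1/24) * X 2 * X 3 ^ 2 - C (1/72) * X 1 ^ 2 * X 2
      + C (1/648) * X 1 * X 2 ^ 3,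
    C (1/12) * X 0 ^ 2 + C (1/24) * X 1 * X 3 ^ 2 - C (1/216) * X 1 ^ 3
      + C (1/144) * X 2 ^ 2 * X 3 ^ 2 + C (1/432) * X 1 ^ 2 * X 2 ^ 2 + C (1/233280) * X 2 ^ 6,
    C (1/2) * X 0 * X 3 + C (1/12) * X 1 * X 2 * X 3 + C (1/216) * X 2 ^ 3 * X 3]

lemma pderiv_D4Potential (γ : Fin 4) : pderiv γ D4Potential = D4Gradient γ := by
  apply MvPolynomial.funext
  intro x
  fin_cases γ <;>
    simp [D4Potential, D4Gradient, pderiv_X, Derivation.leibniz_pow] <;> ring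

set_option maxHeartbeats 1000000 in
lemma pderiv_pderiv_D4Gradient (α β γ : Fin 4) :
    pderiv α (pderiv β (D4Gradient γ)) = D4ThirdDeriv α β γ := by
  apply MvPolynomial.funext
  intro x
  fin_cases γ <;> fin_cases β <;> fin_cases α <;>
    simp [D4Gradient, D4ThirdDeriv, pderiv_X, pderiv_ofNat, Derivation.leibniz_pow] <;> ring

lemma pderiv_pderiv_pderiv_D4Potential (α β γ : Fin 4) :
    pderiv α (pderiv β (pderiv γ D4Potential)) = D4ThirdDeriv α β γ := by
  rw [pderiv_D4Potential, pderiv_pderiv_D4Gradient]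

lemma D4ThirdDeriv_rotate (α β γ : Fin 4) : D4ThirdDeriv α β γ = D4ThirdDeriv γ α β := by
  fin_cases α <;> fin_cases β <;> fin_cases γ <;> rfl

lemma mul_D4Metric_mul_apply (A B : Matrix (Fin 4) (Fin 4) (MvPolynomial (Fin 4) ℂ))
    (β γ : Fin 4) :
    (A * D4Metric.map (C : ℂ → MvPolynomial (Fin 4) ℂ) * B) β γ =
      C 6 * (A β 0 * B 2 γ + A β 1 * B 1 γ + A β 2 * B 0 γ) + C 2 * A β 3 * B 3 γ := by
  simp only [Matrix.mul_apply, Matrix.map_apply, Fin.sum_univ_four]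
  simp [D4Metric]
  ring

set_option maxHeartbeats 2000000 in
lemma D4ThirdDeriv_commute_of_lt {α δ : Fin 4} (h : α < δ) :
    D4ThirdDeriv α * D4Metric.map (C : ℂ → MvPolynomial (Fin 4) ℂ) * D4ThirdDeriv δ =
      D4ThirdDeriv δ * D4Metric.map (C : ℂ → MvPolynomial (Fin 4) ℂ) * D4ThirdDeriv α := by
  ext1 β γ
  rw [mul_D4Metric_mul_apply, mul_D4Metric_mul_apply]
  apply MvPolynomial.funext
  intro x
  fin_cases α <;> fin_cases δ <;> first
    | exact absurd h (by decide)
    | fin_cases β <;> fin_cases γ <;> simp [D4ThirdDeriv] <;> ring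

lemma D4ThirdDeriv_commute (α δ : Fin 4) :
    D4ThirdDeriv α * D4Metric.map (C : ℂ → MvPolynomial (Fin 4) ℂ) * D4ThirdDeriv δ =
      D4ThirdDeriv δ * D4Metric.map (C : ℂ → MvPolynomial (Fin 4) ℂ) * D4ThirdDeriv α := by
  rcases lt_trichotomy α δ with h | rfl | h
  · exact D4ThirdDeriv_commute_of_lt h
  · rfl
  · exact (D4ThirdDeriv_commute_of_lt h).symm

/-- The `D₄` potential `F` satisfies: (i) `∂³F/∂v¹∂v^α∂v^β = η_{αβ}` where
`(η_{αβ})` is the inverse of the matrix `(η^{αβ})`; (ii) the WDVV associativity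
equations; (iii) the quasi-homogeneity `E(F) = (7/3) F` for the Euler vector field
`E = v¹∂₁ + (2/3)v²∂₂ + (1/3)v³∂₃ + (2/3)v⁴∂₄`. -/
theorem D4_potential_frobenius :
    D4Metric * D4MetricInv = 1 ∧
    (∀ α β : Fin 4,
      pderiv 0 (pderiv α (pderiv β D4Potential)) = C (D4MetricInv α β)) ∧
    (∀ α β γ δ : Fin 4,
      ∑ μ : Fin 4, ∑ ν : Fin 4,
        pderiv α (pderiv β (pderiv μ D4Potential)) * C (D4Metric μ ν) *
          pderiv ν (pderiv γ (pderiv δ D4Potential))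
      = ∑ μ : Fin 4, ∑ ν : Fin 4,
        pderiv δ (pderiv β (pderiv μ D4Potential)) * C (D4Metric μ ν) *
          pderiv ν (pderiv γ (pderiv α D4Potential))) ∧
    (X 0 * pderiv 0 D4Potential + C (2/3 : ℂ) * X 1 * pderiv 1 D4Potential
        + C (1/3 : ℂ) * X 2 * pderiv 2 D4Potential
        + C (2/3 : ℂ) * X 3 * pderiv 3 D4Potential
      = C (7/3 : ℂ) * D4Potential) := by
  refine ⟨?_, fun α β => ?_, fun α β γ δ => ?_, ?_⟩
  · ext i j
    fin_cases i <;> fin_cases j <;>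
      simp [D4Metric, D4MetricInv, Matrix.mul_apply, Fin.sum_univ_four]
  · rw [pderiv_pderiv_pderiv_D4Potential]
    fin_cases α <;> fin_cases β <;> simp [D4ThirdDeriv, D4MetricInv]
  · have h := congrFun₂ (D4ThirdDeriv_commute α δ) β γ
    simp only [Matrix.mul_apply, Matrix.map_apply, Finset.sum_mul] at h
    simp only [pderiv_pderiv_pderiv_D4Potential, D4ThirdDeriv_rotate _ γ]
    rw [Finset.sum_comm, h, Finset.sum_comm]
  · simp only [pderiv_D4Potential]
    apply MvPolynomial.funext
    intro x
    simp [D4Potential, D4Gradient]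
    ring
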